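/- For all integers ν ≥ 1 and 0 ≤ M ≤ L, the following identity of Laurent polynomials in q holds: Σ over tuples n = (n_1,…,n_ν) of nonnegative integers of q^{N_1²+⋯+N_ν²−M·N_1} ∏_{i=1}^ν [n_i + L − 2Σ_{l=1}^i N_l choose n_i]_q = Σ_{s=0}^ν C^ν_{0,M}(s,0,1/q) · C^ν_{0,L−M}(s,0,q). -/

import Mathlib

open scoped Classical

noncomputable section

/-- The q-Pochhammer symbol `(q)_n = ∏_{j=1}^n (1 - q^j)`. -/
def qP {F : Type*} [Field F] (q : F) (n : ℕ) : F :=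
  ∏ j ∈ Finset.range n, (1 - q ^ (j + 1))

/-- The q-binomial coefficient `[N choose k]_q = (q)_N / ((q)_k (q)_{N-k})`
for `0 ≤ k ≤ N`, and `0` otherwise. -/
def qB {F : Type*} [Field F] (q : F) (N k : ℤ) : F :=
  if 0 ≤ k ∧ k ≤ N then qP q N.toNat / (qP q k.toNat * qP q (N - k).toNat) else 0

/-- `NN n i = N_i = n_i + n_{i+1} + ⋯ + n_ν` (indices 1-based; `n ⟨k⟩` is `n_{k+1}`). -/
def NN {ν : ℕ} (n : Fin ν → ℕ) (i : ℕ) : ℕ :=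
  ∑ k : Fin ν, if i ≤ (k : ℕ) + 1 then n k else 0

/-- `α_{i,s} = max(0, i - s)`. -/
def alph (i s : ℕ) : ℤ := max 0 ((i : ℤ) - s)

/-- The exponent `N_1² + ⋯ + N_ν² + N_{s+1} + ⋯ + N_ν`. -/
def expAG (ν s : ℕ) (nn : Fin ν → ℕ) : ℕ :=
  (∑ i ∈ Finset.Icc 1 ν, (NN nn i) ^ 2) + ∑ i ∈ Finset.Icc (s + 1) ν, NN nn i

/-- The polynomial `B^ν_{s,b}(L,q)` of Foda–Quano–Kirillov type. -/
def B {F : Type*} [Field F] (ν : ℕ) (s b : ℤ) (L : ℕ) (q : F) : F :=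
  ∑ᶠ j : ℤ,
    (q ^ (j * ((2 * j + 1) * (2 * (ν : ℤ) + 3) - 2 * s)) *
        qB q (L : ℤ) (((L : ℤ) + b - s) / 2 + j * (2 * (ν : ℤ) + 3)) -
      q ^ ((2 * j + 1) * ((2 * (ν : ℤ) + 3) * j + s)) *
        qB q (L : ℤ) (((L : ℤ) + b + s) / 2 + j * (2 * (ν : ℤ) + 3)))

/-- `jjf j l = j_l` for `1 ≤ l ≤ ν` (and junk value `0` otherwise). -/
def jjf {ν : ℕ} (j : Fin ν → ℕ) (l : ℕ) : ℤ :=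
  if h : l - 1 < ν then (j ⟨l - 1, h⟩ : ℤ) else 0

/-- The q-multinomial coefficient `[L choose a]^(p)_ν`. -/
def qMulti {F : Type*} [Field F] (ν L : ℕ) (a : ℤ) (p : ℕ) (q : F) : F :=
  ∑ᶠ j : Fin ν → ℕ,
    if (∑ l, (j l : ℤ)) = a then
      q ^ ((∑ l ∈ Finset.Icc 2 ν, jjf j (l - 1) * ((L : ℤ) - jjf j l)) -
            ∑ l ∈ Finset.Icc 1 p, jjf j l) *
        qB q (L : ℤ) (jjf j ν) * ∏ l ∈ Finset.Icc 2 ν, qB q (jjf j l) (jjf j (l - 1))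
    else 0

/-- The polynomial `W^ν_{s,b}(L,q)` of Warnaar type. -/
def W {F : Type*} [Field F] (ν : ℕ) (s : ℤ) (b L : ℕ) (q : F) : F :=
  ∑ᶠ j : ℤ,
    (q ^ (j * ((2 * j + 1) * (2 * (ν : ℤ) + 3) - 2 * s)) *
        qMulti ν L (((ν : ℤ) * ((L : ℤ) + 1) - s - b + 1) / 2 + (2 * (ν : ℤ) + 3) * j) b q -
      q ^ ((2 * j + 1) * ((2 * (ν : ℤ) + 3) * j + s)) *
        qMulti ν L (((ν : ℤ) * ((L : ℤ) + 1) + s - b + 1) / 2 + (2 * (ν : ℤ) + 3) * j) b q)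

/-! ### Bressoud lattice paths -/

/-- Step values: `0 ↦ NE (+1)`, `1 ↦ SE (−1)`, `2 ↦ horizontal (0)`. -/
def stepVal : Fin 3 → ℤ := ![1, -1, 0]

/-- Height of the path after `k` steps, starting at height `s`. -/
def hts (s : ℤ) {n : ℕ} (d : Fin n → Fin 3) (k : ℕ) : ℤ :=
  s + ∑ i ∈ Finset.range k, if h : i < n then stepVal (d ⟨i, h⟩) else 0

/-- The vertex `k` is a peak: it is preceded by a NE step and followed by a SE step. -/
def IsPeak {n : ℕ} (d : Fin n → Fin 3) (k : ℕ) : Prop :=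
  ∃ hk : k < n, 1 ≤ k ∧ d ⟨k - 1, Nat.lt_of_le_of_lt (Nat.sub_le k 1) hk⟩ = 0 ∧ d ⟨k, hk⟩ = 1

/-- `d` encodes a Bressoud path from height `s` to height `b` whose peaks have height `≤ ν`:
SE steps only from positive height, horizontal steps only on the x-axis. -/
def ValidPath (ν : ℕ) (s b : ℤ) {n : ℕ} (d : Fin n → Fin 3) : Prop :=
  hts s d n = b ∧
    (∀ k : Fin n, (d k = 1 → 0 < hts s d (k : ℕ)) ∧ (d k = 2 → hts s d (k : ℕ) = 0)) ∧
    (∀ k : ℕ, IsPeak d k → hts s d k ≤ (ν : ℤ))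

/-- The weight of a Bressoud path starting at x-coordinate `M`:
the sum of the x-coordinates of its peaks. -/
def pwt (M : ℤ) {n : ℕ} (d : Fin n → Fin 3) : ℤ :=
  ∑ k ∈ Finset.range (n + 1), if IsPeak d k then M + (k : ℤ) else 0

/-- `C^ν_{M,L}(s,b,q)`: the weighted count of Bressoud paths from `(M,s)` to `(L,b)`
with no peak higher than `ν`. -/
def Cpoly {F : Type*} [Field F] (ν : ℕ) (M L : ℤ) (s b : ℕ) (q : F) : F :=
  ∑ d ∈ Finset.univ.filter (fun d : Fin (L - M).toNat → Fin 3 => ValidPath ν (s : ℤ) (b : ℤ) d),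
    q ^ pwt M d

/-- `t` is an admissible relative height for the peak at vertex `k`. -/
def RelProp (s : ℤ) {n : ℕ} (d : Fin n → Fin 3) (k t : ℕ) : Prop :=
  0 < t ∧ ∃ k' k'' : ℕ, k' < k ∧ k < k'' ∧ k'' ≤ n ∧
    hts s d k' = hts s d k - t ∧ hts s d k'' = hts s d k - t ∧
    ∀ m : ℕ, k' < m → m < k'' → IsPeak d m →
      hts s d m ≤ hts s d k ∧ (hts s d m = hts s d k → k ≤ m)

/-- The relative height of the peak at vertex `k`: the largest `t` with `RelProp`. -/
def relHt (ν : ℕ) (s : ℤ) {n : ℕ} (d : Fin n → Fin 3) (k : ℕ) : ℕ :=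
  Nat.findGreatest (RelProp s d k) (ν + n)

/-- `P^ν_{M,L}(s,b,n)`: Bressoud paths from `(M,s)` to `(L,b)`, peaks of height at most `ν`,
with exactly `nn j` peaks of relative height `j+1`. -/
def Pset (ν : ℕ) (M L : ℤ) (s b : ℤ) (nn : Fin ν → ℕ) : Finset (Fin (L - M).toNat → Fin 3) :=
  Finset.univ.filter (fun d => ValidPath ν s b d ∧
    ∀ j : Fin ν, ((Finset.range ((L - M).toNat + 1)).filter
      (fun k => IsPeak d k ∧ relHt ν s d k = (j : ℕ) + 1)).card = nn j)

/-! ### Gordon lattice paths -/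

/-- `f` encodes a Gordon path of length `n` from height `s` to height `b`:
`f 0 = s`, `f n = b`, adjacent frequencies sum to at most `ν`; values beyond `n` are `0`. -/
def IsGordon (ν n s b : ℕ) (f : ℕ → ℕ) : Prop :=
  f 0 = s ∧ f n = b ∧ (∀ k, k < n → f k + f (k + 1) ≤ ν) ∧ (∀ k, n < k → f k = 0)

/-- The weight `Σ_{j=M+1}^{L-1} j f_j` of a Gordon path starting at x-coordinate `M`. -/
def gwt (M : ℤ) (n : ℕ) (f : ℕ → ℕ) : ℤ :=
  ∑ k ∈ Finset.Ioo 0 n, (M + (k : ℤ)) * (f k : ℤ)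

/-- `G^ν_{M,L}(s,b,q)`: the weighted count of Gordon paths from `(M,s)` to `(L,b)`. -/
def G {F : Type*} [Field F] (ν : ℕ) (M L : ℤ) (s b : ℕ) (q : F) : F :=
  ∑ᶠ f : ℕ → ℕ, if IsGordon ν (L - M).toNat s b f then q ^ gwt M (L - M).toNat f else 0

/-- `F^ν_{s,b}(L,q)` of (2.21). -/
def Fpoly {F : Type*} [Field F] (ν s b L : ℕ) (q : F) : F :=
  ∑ᶠ nn : Fin ν → ℕ, q ^ expAG ν s nn *
    ∏ i : Fin ν, qB q ((nn i : ℤ) + ((i : ℕ) + 1) * (L : ℤ) -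
      2 * (∑ l ∈ Finset.Icc 1 ((i : ℕ) + 1), (NN nn l : ℤ)) -
      alph ((i : ℕ) + 1) s - alph ((i : ℕ) + 1) b) (nn i)

/-- The left-hand side of (4.2): `F` with the extra `−M(N_1+⋯+N_ν)` in the exponent. -/
def FpolyM {F : Type*} [Field F] (ν s b L M : ℕ) (q : F) : F :=
  ∑ᶠ nn : Fin ν → ℕ,
    q ^ ((expAG ν s nn : ℤ) - (M : ℤ) * ∑ i ∈ Finset.Icc 1 ν, (NN nn i : ℤ)) *
    ∏ i : Fin ν, qB q ((nn i : ℤ) + ((i : ℕ) + 1) * (L : ℤ) -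
      2 * (∑ l ∈ Finset.Icc 1 ((i : ℕ) + 1), (NN nn l : ℤ)) -
      alph ((i : ℕ) + 1) s - alph ((i : ℕ) + 1) b) (nn i)


abbrev K : Type := RatFunc ℚ


section helpers

variable {F : Type*} [Field F]

/-- transfer polynomials with height start `s`, length `k - 1`. -/
def Atr (ν : ℕ) (q : F) : ℕ → F → ℕ → F
  | 0, _, _ => 0
  | 1, _, s => if s = 0 then 1 else 0
  | k + 2, z, s =>
    if s < ν then
      Atr ν q (k + 1) (z * q) (s + 1) + Atr ν q (k + 1) (z * q) (s - 1)
        - (1 - z * q) * Atr ν q k (z * q * q) s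
    else if s = ν then Atr ν q (k + 1) (z * q) (s - 1) else 0

/-- coefficients of `z ^ N` in `Atr`. -/
def acf (ν : ℕ) (q : F) : ℕ → ℕ → ℕ → F
  | 0, _, _ => 0
  | 1, N, s => if s = 0 ∧ N = 0 then 1 else 0
  | k + 2, 0, s =>
    if s < ν then
      acf ν q (k + 1) 0 (s + 1) + acf ν q (k + 1) 0 (s - 1) - acf ν q k 0 s
    else if s = ν then acf ν q (k + 1) 0 (s - 1) else 0
  | k + 2, N + 1, s =>
    if s < ν then
      q ^ (N + 1) * (acf ν q (k + 1) (N + 1) (s + 1) + acf ν q (k + 1) (N + 1) (s - 1))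
        - q ^ (2 * (N + 1)) * acf ν q k (N + 1) s + q ^ (2 * N + 1) * acf ν q k N s
    else if s = ν then q ^ (N + 1) * acf ν q (k + 1) (N + 1) (s - 1) else 0

theorem acf_vanish (ν : ℕ) (q : F) : ∀ k N s, k ≤ N → acf ν q k N s = 0 := by
  intro k
  induction k using Nat.strong_induction_on with
  | _ k ih =>
    intro N s h
    match k, N, h with
    | 0, N, _ => simp [acf]
    | 1, N + 1, _ => simp [acf]
    | k + 2, N + 1, h =>
      simp only [acf]
      rw [ih (k + 1) (by omega) (N + 1) (s + 1) (by omega),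
        ih (k + 1) (by omega) (N + 1) (s - 1) (by omega),
        ih k (by omega) (N + 1) s (by omega), ih k (by omega) N s (by omega)]
      simp

theorem Atr_eq_sum (ν : ℕ) (q : F) : ∀ k R, k ≤ R → ∀ z s,
    Atr ν q k z s = ∑ N ∈ Finset.range R, z ^ N * acf ν q k N s := by
  intro k
  induction k using Nat.strong_induction_on with
  | _ k ih =>
    intro R h z s
    match k, R, h with
    | 0, R, _ => simp [Atr, acf]
    | 1, R + 1, _ => rw [Finset.sum_range_succ']; simp [Atr, acf]
    | k + 2, R + 1, h =>
      rw [Finset.sum_range_succ']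
      simp only [Atr, acf]
      have e1 : ∀ s', Atr ν q (k + 1) (z * q) s' = _ := fun s' =>
        ih (k + 1) (by omega) (R + 1) (by omega) (z * q) s'
      have e2 := ih k (by omega) (R + 1) (by omega) (z * q * q) s
      have e3 := ih k (by omega) R (by omega) (z * q * q) s
      have e2' : (1 - z * q) * Atr ν q k (z * q * q) s =
          (∑ N ∈ Finset.range (R + 1), (z * q * q) ^ N * acf ν q k N s)
          - z * q * ∑ N ∈ Finset.range R, (z * q * q) ^ N * acf ν q k N s := by
        rw [← e2, ← e3]; ring
      split_ifs with h1 h2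
      · rw [e2', e1, e1]
        simp only [Finset.sum_range_succ' _ R, Finset.mul_sum]
        have key : ∑ N ∈ Finset.range R, z ^ (N + 1) *
            (q ^ (N + 1) * (acf ν q (k + 1) (N + 1) (s + 1) + acf ν q (k + 1) (N + 1) (s - 1))
            - q ^ (2 * (N + 1)) * acf ν q k (N + 1) s + q ^ (2 * N + 1) * acf ν q k N s) =
            ∑ N ∈ Finset.range R, (z * q) ^ (N + 1) * acf ν q (k + 1) (N + 1) (s + 1) +
            ∑ N ∈ Finset.range R, (z * q) ^ (N + 1) * acf ν q (k + 1) (N + 1) (s - 1) -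
            ∑ N ∈ Finset.range R, (z * q * q) ^ (N + 1) * acf ν q k (N + 1) s +
            ∑ N ∈ Finset.range R, z * q * ((z * q * q) ^ N * acf ν q k N s) := by
          rw [← Finset.sum_add_distrib, ← Finset.sum_sub_distrib, ← Finset.sum_add_distrib]
          refine Finset.sum_congr rfl fun N _ => ?_
          ring
        rw [key]; ring
      · rw [e1, Finset.sum_range_succ']
        congr 1
        · refine Finset.sum_congr rfl fun N _ => ?_
          ring
        · simp
      · simp

/-- the q-binomial `[l + k choose k]`. -/
def bet (q : F) (l k : ℕ) : F := qP q (l + k) / (qP q k * qP q l)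

theorem bet_zero_right (q : F) (hq : ∀ n, qP q n ≠ 0) (l : ℕ) : bet q l 0 = 1 := by
  have := hq l
  simp [bet, qP] at *
  exact this

theorem bet_zero_left (q : F) (hq : ∀ n, qP q n ≠ 0) (k : ℕ) : bet q 0 k = 1 := by
  have := hq k
  simp [bet, qP] at *
  exact this

theorem qP_succ (q : F) (n : ℕ) : qP q (n + 1) = qP q n * (1 - q ^ (n + 1)) := by
  simp [qP, Finset.prod_range_succ]

theorem bet_pascal (q : F) (hq : ∀ n, qP q n ≠ 0) (l k : ℕ) :
    bet q (l + 1) (k + 1) = bet q (l + 1) k + q ^ (k + 1) * bet q l (k + 1) := by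
  have h1 := hq l
  have h2 := hq k
  have h3 := hq (l + 1)
  have h4 := hq (k + 1)
  unfold bet
  rw [show l + 1 + (k + 1) = (l + k + 1) + 1 by ring, show l + 1 + k = l + k + 1 by ring,
    show l + (k + 1) = l + k + 1 by ring, qP_succ q (l + k + 1)]
  rw [qP_succ] at h3 h4
  rw [qP_succ q k, qP_succ q l]
  have h5 : (1 - q ^ (l + 1)) ≠ 0 := right_ne_zero_of_mul h3
  have h6 : (1 - q ^ (k + 1)) ≠ 0 := right_ne_zero_of_mul h4
  field_simp
  ring

theorem qB_eq_bet (q : F) (l k : ℕ) : qB q ((l : ℤ) + k) k = bet q l k := by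
  unfold qB bet
  rw [if_pos ⟨by positivity, by omega⟩]
  rw [show ((l : ℤ) + k).toNat = l + k by omega, show ((k : ℤ)).toNat = k by omega,
    show ((l : ℤ) + k - k).toNat = l by omega]

/-- lifting operator -/
def Tl (q : F) (u : ℕ → ℕ → F) (k N : ℕ) : F :=
  q ^ (N ^ 2) * ∑ m ∈ Finset.range (N + 1), bet q (k - 2 * N - 1) (N - m) * u (k - 2 * N) m

theorem acf_top (μ : ℕ) (q : F) (k N : ℕ) :
    acf (μ + 1) q (k + 1) N (μ + 1) = q ^ N * acf (μ + 1) q k N μ := by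
  match k, N with
  | 0, N => simp [acf]
  | k + 1, 0 => simp [acf]
  | k + 1, N + 1 => simp [acf]

/-- Pascal summed against a sequence. -/
theorem pascal_sum (q : F) (hq : ∀ n, qP q n ≠ 0) (j N : ℕ) (w : ℕ → F) :
    ∑ m ∈ Finset.range (N + 2), bet q (j + 1) (N + 1 - m) * w m =
      ∑ m ∈ Finset.range (N + 1), bet q (j + 1) (N - m) * w m +
      ∑ m ∈ Finset.range (N + 2), q ^ (N + 1 - m) * bet q j (N + 1 - m) * w m := by
  rw [Finset.sum_range_succ, Finset.sum_range_succ _ (N + 1), ← add_assoc,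
    ← Finset.sum_add_distrib]
  congr 1
  · refine Finset.sum_congr rfl fun m hm => ?_
    have : m ≤ N := by simpa [Nat.lt_succ_iff] using hm
    obtain ⟨c, rfl⟩ := Nat.exists_eq_add_of_le this
    rw [show m + c + 1 - m = c + 1 by omega, show m + c - m = c by omega, bet_pascal q hq]
    ring
  · simp [bet_zero_right q hq]

theorem lift_mid (q : F) (hq : ∀ n, qP q n ≠ 0) (j N : ℕ) (x y w : ℕ → F)
    (hw0 : w 0 = x 0 - y 0) (hy : j = 0 → ∀ m, y m = 0)
    (hw : ∀ m, w (m + 1) = q ^ (m + 1) * x (m + 1) - q ^ (2 * (m + 1)) * y (m + 1)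
      + q ^ (2 * m + 1) * y m) :
    ∑ m ∈ Finset.range (N + 2), bet q (j + 1) (N + 1 - m) * w m =
      q ^ (N + 1) * ∑ m ∈ Finset.range (N + 2), bet q j (N + 1 - m) * x m
      - q ^ (2 * (N + 1)) * ∑ m ∈ Finset.range (N + 2), bet q (j - 1) (N + 1 - m) * y m
      + ∑ m ∈ Finset.range (N + 1), bet q (j + 1) (N - m) * w m := by
  rw [pascal_sum q hq, add_comm, add_left_inj]
  -- split w
  have e1 : ∑ m ∈ Finset.range (N + 2), q ^ (N + 1 - m) * bet q j (N + 1 - m) * w m =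
      q ^ (N + 1) * ∑ m ∈ Finset.range (N + 2), bet q j (N + 1 - m) * x m
      - ∑ m ∈ Finset.range (N + 2), q ^ (N + 1 + m) * bet q j (N + 1 - m) * y m
      + ∑ m ∈ Finset.range (N + 1), q ^ (N + 1 + m) * bet q j (N - m) * y m := by
    simp only [Finset.sum_range_succ' _ (N + 1), Finset.mul_sum, mul_add]
    have : ∑ m ∈ Finset.range (N + 1),
        q ^ (N + 1 - (m + 1)) * bet q j (N + 1 - (m + 1)) * w (m + 1) =
        ∑ m ∈ Finset.range (N + 1), q ^ (N + 1) * (bet q j (N + 1 - (m + 1)) * x (m + 1))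
        - ∑ m ∈ Finset.range (N + 1),
            q ^ (N + 1 + (m + 1)) * bet q j (N + 1 - (m + 1)) * y (m + 1)
        + ∑ m ∈ Finset.range (N + 1), q ^ (N + 1 + m) * bet q j (N - m) * y m := by
      rw [← Finset.sum_sub_distrib, ← Finset.sum_add_distrib]
      refine Finset.sum_congr rfl fun m hm => ?_
      have : m ≤ N := by simpa [Nat.lt_succ_iff] using hm
      obtain ⟨c, rfl⟩ := Nat.exists_eq_add_of_le this
      rw [show m + c + 1 - (m + 1) = c by omega, show m + c - m = c by omega, hw]
      ring
    rw [this, hw0]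
    simp only [Nat.sub_zero, Nat.add_zero]
    ring
  rw [e1]
  have e2 : ∑ m ∈ Finset.range (N + 2), q ^ (N + 1 + m) * bet q j (N + 1 - m) * y m =
      ∑ m ∈ Finset.range (N + 1), q ^ (N + 1 + m) * bet q j (N - m) * y m +
      q ^ (2 * (N + 1)) * ∑ m ∈ Finset.range (N + 2), bet q (j - 1) (N + 1 - m) * y m := by
    rcases j with _ | j
    · simp [hy rfl]
    · have := pascal_sum q hq j N (fun m => q ^ (N + 1 + m) * y m)
      simp only [Nat.add_sub_cancel]
      rw [Finset.mul_sum]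
      convert this using 1
      · exact Finset.sum_congr rfl fun m _ => by ring
      · congr 1
        · exact Finset.sum_congr rfl fun m _ => by ring
        · refine Finset.sum_congr rfl fun m hm => ?_
          have : m ≤ N + 1 := by simpa [Nat.lt_succ_iff] using hm
          obtain ⟨c, hc⟩ := Nat.exists_eq_add_of_le this
          rw [hc, show m + c - m = c by omega]
          ring
  rw [e2]
  ring

theorem acf_two_zero (ν : ℕ) (q : F) (k s : ℕ) : acf ν q (k + 2) 0 s =
    if s < ν then
      acf ν q (k + 1) 0 (s + 1) + acf ν q (k + 1) 0 (s - 1) - acf ν q k 0 s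
    else if s = ν then acf ν q (k + 1) 0 (s - 1) else 0 := by simp only [acf]

theorem acf_two_succ (ν : ℕ) (q : F) (k N s : ℕ) : acf ν q (k + 2) (N + 1) s =
    if s < ν then
      q ^ (N + 1) * (acf ν q (k + 1) (N + 1) (s + 1) + acf ν q (k + 1) (N + 1) (s - 1))
        - q ^ (2 * (N + 1)) * acf ν q k (N + 1) s + q ^ (2 * N + 1) * acf ν q k N s
    else if s = ν then q ^ (N + 1) * acf ν q (k + 1) (N + 1) (s - 1) else 0 := by
  simp only [acf]

theorem Tl_zero (q : F) (hq : ∀ n, qP q n ≠ 0) (u : ℕ → ℕ → F) (k : ℕ) :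
    Tl q u k 0 = u k 0 := by
  simp [Tl, bet_zero_right q hq]

theorem Tl_small (q : F) (u : ℕ → ℕ → F) (hu : ∀ m, u 0 m = 0) (k N : ℕ) (h : k ≤ 2 * N) :
    Tl q u k N = 0 := by
  simp [Tl, Nat.sub_eq_zero_of_le h, hu]

theorem lift_main (ν : ℕ) (q : F) (hq : ∀ n, qP q n ≠ 0) : ∀ k N s, s ≤ ν →
    acf (ν + 1) q k N s = Tl q (fun k m => acf ν q k m s) k N := by
  intro k
  induction k using Nat.strong_induction_on with
  | _ k ih =>
    intro N s hs
    match k, N with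
    | 0, N => simp [acf, Tl]
    | 1, 0 =>
      rw [Tl_zero q hq]
      simp only [acf]
    | 1, N + 1 =>
      rw [Tl_small _ _ (by simp [acf]) _ _ (by omega)]
      simp [acf]
    | k + 2, 0 =>
      rw [Tl_zero q hq, acf_two_zero, acf_two_zero, if_pos (by omega),
        ih k (by omega) _ _ hs, ih (k + 1) (by omega) _ (s - 1) (by omega)]
      simp only [Tl_zero q hq]
      split_ifs with h1 h2
      · rw [ih (k + 1) (by omega) _ (s + 1) (by omega)]
        simp only [Tl_zero q hq]
      · subst h2
        rw [acf_top, ih k (by omega) _ _ le_rfl]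
        simp only [Tl_zero q hq]
        ring
      · omega
    | k + 2, N + 1 =>
      rw [acf_two_succ, if_pos (by omega), ih (k + 1) (by omega) _ (s - 1) (by omega),
        ih k (by omega) _ _ hs, ih k (by omega) _ _ hs]
      have hz : ∀ s' m, acf ν q 0 m s' = 0 := by simp [acf]
      rcases Nat.lt_or_ge (k + 2) (2 * N + 4) with hlt | hge
      · -- small cases
        have hup : acf (ν + 1) q (k + 1) (N + 1) (s + 1) = 0 := by
          rcases Nat.lt_or_ge s ν with h1 | h1
          · rw [ih (k + 1) (by omega) _ (s + 1) (by omega)]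
            exact Tl_small _ _ (hz _) _ _ (by omega)
          · have : s = ν := by omega
            subst this
            rw [acf_top, ih k (by omega) _ _ le_rfl, Tl_small _ _ (hz _) _ _ (by omega), mul_zero]
        rw [hup, Tl_small _ (fun k m => acf ν q k m (s - 1)) (hz _) _ _ (by omega),
          Tl_small _ _ (hz _) k (N + 1) (by omega)]
        rcases Nat.lt_or_ge (k + 2) (2 * N + 3) with h2 | h2
        · rw [Tl_small _ _ (hz _) _ _ (by omega), Tl_small _ _ (hz _) _ _ (by omega)]
          ring
        · have : k = 2 * N + 1 := by omega
          subst this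
          simp only [Tl]
          rw [show 2 * N + 1 - 2 * N = 1 by omega, show 2 * N + 1 + 2 - 2 * (N + 1) = 1 by omega]
          rw [Finset.sum_range_succ', Finset.sum_range_succ' _ (N + 1)]
          simp [acf, bet_zero_left q hq]
          ring
      · obtain ⟨j, rfl⟩ : ∃ j, k = 2 * N + 2 + j := ⟨k - (2 * N + 2), by omega⟩
        have T1 : ∀ u : ℕ → ℕ → F, Tl q u (2 * N + 2 + j + 1) (N + 1) = q ^ ((N + 1) ^ 2) *
            ∑ m ∈ Finset.range (N + 2), bet q j (N + 1 - m) * u (j + 1) m := by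
          intro u
          simp only [Tl]
          rw [show 2 * N + 2 + j + 1 - 2 * (N + 1) = j + 1 by omega]
          rfl
        have T0 : ∀ u : ℕ → ℕ → F, Tl q u (2 * N + 2 + j) (N + 1) = q ^ ((N + 1) ^ 2) *
            ∑ m ∈ Finset.range (N + 2), bet q (j - 1) (N + 1 - m) * u j m := by
          intro u
          simp only [Tl]
          rw [show 2 * N + 2 + j - 2 * (N + 1) = j by omega]
        have T2 : ∀ u : ℕ → ℕ → F, Tl q u (2 * N + 2 + j + 2) (N + 1) = q ^ ((N + 1) ^ 2) *
            ∑ m ∈ Finset.range (N + 2), bet q (j + 1) (N + 1 - m) * u (j + 2) m := by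
          intro u
          simp only [Tl]
          rw [show 2 * N + 2 + j + 2 - 2 * (N + 1) = j + 2 by omega]
          rfl
        have T3 : ∀ u : ℕ → ℕ → F, q ^ (2 * N + 1) * Tl q u (2 * N + 2 + j) N =
            q ^ ((N + 1) ^ 2) *
            ∑ m ∈ Finset.range (N + 1), bet q (j + 1) (N - m) * u (j + 2) m := by
          intro u
          simp only [Tl]
          rw [show 2 * N + 2 + j - 2 * N = j + 2 by omega]
          rw [← mul_assoc]
          congr 1
          ring
        rw [T3, T2]
        rcases Nat.lt_or_ge s ν with h1 | h1
        · rw [ih (2 * N + 2 + j + 1) (by omega) _ (s + 1) (by omega), T1, T1, T0]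
          have := lift_mid q hq j N
            (fun m => acf ν q (j + 1) m (s + 1) + acf ν q (j + 1) m (s - 1))
            (fun m => acf ν q j m s) (fun m => acf ν q (j + 2) m s)
            (by simp only [acf_two_zero, if_pos h1])
            (by rintro rfl m; simp [acf])
            (fun m => by simp only [acf_two_succ, if_pos h1])
          rw [this]
          simp only [mul_add, Finset.sum_add_distrib]
          ring
        · have : s = ν := by omega
          subst this
          rw [acf_top, ih (2 * N + 2 + j) (by omega) _ _ le_rfl, T1, T0]
          have := lift_mid q hq j N
            (fun m => acf s q (j + 1) m (s - 1))
            (fun m => 0) (fun m => acf s q (j + 2) m s)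
            (by simp only [acf_two_zero, lt_irrefl, if_false, if_true]; ring)
            (fun _ _ => rfl)
            (fun m => by simp only [acf_two_succ, lt_irrefl, if_false, if_true]; ring)
          rw [this]
          simp
          ring

/-! gluing -/

/-- two-sided sums, cut at a vertex of weight `z` -/
def Hg (ν : ℕ) (q : F) (M K : ℕ) (z : F) : F :=
  ∑ s ∈ Finset.range (ν + 1), Atr ν q⁻¹ (M + 1) z s * Atr ν q (K + 1) z s
    - (1 - z) * ∑ s ∈ Finset.range ν, Atr ν q⁻¹ M (z * q⁻¹) s * Atr ν q K (z * q) s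

theorem tri_symm (ν : ℕ) (a b : ℕ → F) :
    ∑ s ∈ Finset.range ν, (a (s + 1) + a (s - 1)) * b s + a (ν - 1) * b ν =
    ∑ s ∈ Finset.range ν, a s * (b (s + 1) + b (s - 1)) + a ν * b (ν - 1) := by
  induction ν with
  | zero => simp
  | succ n ih =>
    rw [Finset.sum_range_succ, Finset.sum_range_succ]
    simp only [Nat.add_sub_cancel]
    linear_combination ih

theorem Hg_move (ν : ℕ) (q : F) (hq : q ≠ 0) (M K : ℕ) (z : F) :
    Hg ν q (M + 1) K (z * q) = Hg ν q M (K + 1) z := by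
  unfold Hg
  have h1 : z * q * q⁻¹ = z := by field_simp
  rw [Finset.sum_range_succ, Finset.sum_range_succ]
  have e1 : ∑ s ∈ Finset.range ν, Atr ν q⁻¹ (M + 1 + 1) (z * q) s * Atr ν q (K + 1) (z * q) s =
      ∑ s ∈ Finset.range ν, (Atr ν q⁻¹ (M + 1) z (s + 1) + Atr ν q⁻¹ (M + 1) z (s - 1)) *
        Atr ν q (K + 1) (z * q) s - (1 - z) *
        ∑ s ∈ Finset.range ν, Atr ν q⁻¹ M (z * q⁻¹) s * Atr ν q (K + 1) (z * q) s := by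
    rw [Finset.mul_sum, ← Finset.sum_sub_distrib]
    refine Finset.sum_congr rfl fun s hs => ?_
    rw [Atr, if_pos (Finset.mem_range.1 hs), h1]
    ring
  have e2 : ∑ s ∈ Finset.range ν, Atr ν q⁻¹ (M + 1) z s * Atr ν q (K + 1 + 1) z s =
      ∑ s ∈ Finset.range ν, Atr ν q⁻¹ (M + 1) z s *
        (Atr ν q (K + 1) (z * q) (s + 1) + Atr ν q (K + 1) (z * q) (s - 1)) - (1 - z * q) *
        ∑ s ∈ Finset.range ν, Atr ν q⁻¹ (M + 1) z s * Atr ν q K (z * q * q) s := by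
    rw [Finset.mul_sum, ← Finset.sum_sub_distrib]
    refine Finset.sum_congr rfl fun s hs => ?_
    rw [Atr, if_pos (Finset.mem_range.1 hs)]
    ring
  have e3 : Atr ν q⁻¹ (M + 1 + 1) (z * q) ν = Atr ν q⁻¹ (M + 1) z (ν - 1) := by
    rw [Atr, h1]; simp
  have e4 : Atr ν q (K + 1 + 1) z ν = Atr ν q (K + 1) (z * q) (ν - 1) := by
    rw [Atr]; simp
  rw [e1, e2, e3, e4, h1]
  linear_combination tri_symm ν (Atr ν q⁻¹ (M + 1) z) (Atr ν q (K + 1) (z * q))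

theorem Hg_eq (ν : ℕ) (q : F) (hq : q ≠ 0) : ∀ (M K : ℕ) (z : F),
    Hg ν q M K (z * q ^ M) = Atr ν q (M + K + 1) z 0 := by
  intro M
  induction M with
  | zero =>
    intro K z
    unfold Hg
    rw [Finset.sum_range_succ']
    simp [Atr]
  | succ M ih =>
    intro K z
    rw [pow_succ, ← mul_assoc, Hg_move ν q hq, ih]
    congr 1
    omega

/-! paths -/

/-- the path starts with a SE step -/
def SSE {n : ℕ} (d : Fin n → Fin 3) : Prop := ∃ h : 0 < n, d ⟨0, h⟩ = 1

theorem hts_zero (s : ℤ) {n : ℕ} (d : Fin n → Fin 3) : hts s d 0 = s := by simp [hts]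

theorem hts_cons (s : ℤ) {n : ℕ} (c : Fin 3) (d : Fin n → Fin 3) (k : ℕ) :
    hts s (Fin.cons c d : Fin (n + 1) → Fin 3) (k + 1) = hts (s + stepVal c) d k := by
  unfold hts
  rw [Finset.sum_range_succ']
  have : ∀ i, (if h : i + 1 < n + 1 then
      stepVal ((Fin.cons c d : Fin (n + 1) → Fin 3) ⟨i + 1, h⟩) else 0) =
      if h : i < n then stepVal (d ⟨i, h⟩) else 0 := by
    intro i
    by_cases h : i < n
    · rw [dif_pos h, dif_pos (by omega)]
      rfl
    · rw [dif_neg h, dif_neg (by omega)]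
  simp only [this]
  rw [dif_pos (by omega)]
  have : (Fin.cons c d : Fin (n + 1) → Fin 3) ⟨0, by omega⟩ = c := rfl
  rw [this]
  ring

theorem isPeak_zero {n : ℕ} (d : Fin n → Fin 3) : ¬ IsPeak d 0 := by
  rintro ⟨_, h, _⟩
  omega

theorem isPeak_one {n : ℕ} (c : Fin 3) (d : Fin n → Fin 3) :
    IsPeak (Fin.cons c d : Fin (n + 1) → Fin 3) 1 ↔ c = 0 ∧ SSE d := by
  constructor
  · rintro ⟨h, _, h1, h2⟩
    exact ⟨h1, by omega, h2⟩
  · rintro ⟨h1, h, h2⟩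
    exact ⟨by omega, le_rfl, (show (Fin.cons c d : Fin (n + 1) → Fin 3) 0 = 0 from h1), h2⟩

theorem isPeak_succ {n : ℕ} (c : Fin 3) (d : Fin n → Fin 3) (k : ℕ) :
    IsPeak (Fin.cons c d : Fin (n + 1) → Fin 3) (k + 2) ↔ IsPeak d (k + 1) := by
  constructor
  · rintro ⟨h, _, h1, h2⟩
    exact ⟨by omega, by omega, h1, h2⟩
  · rintro ⟨h, _, h1, h2⟩
    exact ⟨by omega, by omega, h1, h2⟩

theorem valid_cons (ν : ℕ) (s b : ℤ) {n : ℕ} (c : Fin 3) (d : Fin n → Fin 3) :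
    ValidPath ν s b (Fin.cons c d : Fin (n + 1) → Fin 3) ↔
      (c = 1 → 0 < s) ∧ (c = 2 → s = 0) ∧ ValidPath ν (s + stepVal c) b d ∧
      (c = 0 → SSE d → s + 1 ≤ ν) := by
  unfold ValidPath
  rw [hts_cons]
  have h1 : (∀ k : Fin (n + 1),
      ((Fin.cons c d : Fin (n + 1) → Fin 3) k = 1 →
        0 < hts s (Fin.cons c d : Fin (n + 1) → Fin 3) (k : ℕ)) ∧
      ((Fin.cons c d : Fin (n + 1) → Fin 3) k = 2 →
        hts s (Fin.cons c d : Fin (n + 1) → Fin 3) (k : ℕ) = 0)) ↔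
      ((c = 1 → 0 < s) ∧ (c = 2 → s = 0)) ∧ ∀ k : Fin n, (d k = 1 → 0 < hts (s + stepVal c) d k)
        ∧ (d k = 2 → hts (s + stepVal c) d k = 0) := by
    rw [Fin.forall_fin_succ]
    simp only [Fin.cons_zero, Fin.cons_succ, Fin.val_zero, hts_zero, Fin.val_succ, hts_cons]
  have h2 : (∀ k : ℕ, IsPeak (Fin.cons c d : Fin (n + 1) → Fin 3) k →
      hts s (Fin.cons c d : Fin (n + 1) → Fin 3) k ≤ (ν : ℤ)) ↔
      (c = 0 → SSE d → s + 1 ≤ ν) ∧ ∀ k : ℕ, IsPeak d k → hts (s + stepVal c) d k ≤ (ν : ℤ) := by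
    constructor
    · intro h
      refine ⟨fun hc hd => ?_, fun k hk => ?_⟩
      · have := h 1 ((isPeak_one c d).2 ⟨hc, hd⟩)
        rw [hts_cons, hts_zero, hc] at this
        simpa [stepVal] using this
      · rcases k with _ | k
        · exact absurd hk (isPeak_zero d)
        · have := h (k + 2) ((isPeak_succ c d k).2 hk)
          rwa [hts_cons] at this
    · rintro ⟨ha, hb⟩ k hk
      rcases k with _ | _ | k
      · exact absurd hk (isPeak_zero _)
      · obtain ⟨hc, hd⟩ := (isPeak_one c d).1 hk
        rw [hts_cons, hts_zero, hc]
        simpa [stepVal] using ha hc hd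
      · rw [hts_cons]
        exact hb _ ((isPeak_succ c d k).1 hk)
  rw [h1, h2]
  tauto

theorem pwt_cons (M : ℤ) {n : ℕ} (c : Fin 3) (d : Fin n → Fin 3) :
    pwt M (Fin.cons c d : Fin (n + 1) → Fin 3) =
      pwt (M + 1) d + if c = 0 ∧ SSE d then M + 1 else 0 := by
  unfold pwt
  rw [Finset.sum_range_succ', Finset.sum_range_succ', Finset.sum_range_succ' _ n]
  simp only [isPeak_zero, if_false, isPeak_one, isPeak_succ]
  simp only [zero_add, isPeak_one, add_zero]
  congr 1
  refine Finset.sum_congr rfl fun k _ => ?_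
  congr 1
  push_cast
  ring

/-- path sums -/
def Sp (ν : ℕ) (q : F) (n : ℕ) (M s : ℤ) : F :=
  ∑ d : Fin n → Fin 3, if ValidPath ν s 0 d then q ^ pwt M d else 0

/-- path sums, first step SE -/
def Dp (ν : ℕ) (q : F) (n : ℕ) (M s : ℤ) : F :=
  ∑ d : Fin n → Fin 3, if ValidPath ν s 0 d ∧ SSE d then q ^ pwt M d else 0

/-- path sums, preceded by a NE step -/
def Up (ν : ℕ) (q : F) (n : ℕ) (M s : ℤ) : F :=
  ∑ d : Fin n → Fin 3, if ValidPath ν s 0 d ∧ (SSE d → s ≤ ν) then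
    q ^ (pwt M d + if SSE d then M else 0) else 0

theorem sum_cons {n : ℕ} (f : (Fin (n + 1) → Fin 3) → F) :
    ∑ d, f d = ∑ d : Fin n → Fin 3, (f (Fin.cons 0 d) + f (Fin.cons 1 d) + f (Fin.cons 2 d)) := by
  rw [← (Fin.consEquiv (fun _ : Fin (n + 1) => Fin 3)).sum_comp, Fintype.sum_prod_type,
    Finset.sum_comm]
  refine Finset.sum_congr rfl fun d _ => ?_
  rw [Fin.sum_univ_three]
  rfl

theorem Sp_succ (ν : ℕ) (q : F) (n : ℕ) (M s : ℤ) :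
    Sp ν q (n + 1) M s = Up ν q n (M + 1) (s + 1) +
      (if 0 < s then Sp ν q n (M + 1) (s - 1) else 0) +
      (if s = 0 then Sp ν q n (M + 1) s else 0) := by
  have h1 : (if 0 < s then Sp ν q n (M + 1) (s - 1) else 0) =
      ∑ d : Fin n → Fin 3, if 0 < s ∧ ValidPath ν (s - 1) 0 d then q ^ pwt (M + 1) d else 0 := by
    split_ifs with h <;> simp [h, Sp]
  have h2 : (if s = 0 then Sp ν q n (M + 1) s else 0) =
      ∑ d : Fin n → Fin 3, if s = 0 ∧ ValidPath ν s 0 d then q ^ pwt (M + 1) d else 0 := by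
    split_ifs with h <;> simp [h, Sp]
  rw [h1, h2, Sp, Up, sum_cons, ← Finset.sum_add_distrib, ← Finset.sum_add_distrib]
  refine Finset.sum_congr rfl fun d _ => ?_
  simp only [valid_cons, pwt_cons]
  simp [stepVal, sub_eq_add_neg]

theorem Dp_zero (ν : ℕ) (q : F) (M s : ℤ) : Dp ν q 0 M s = 0 := by
  simp [Dp, SSE]

theorem Dp_succ (ν : ℕ) (q : F) (n : ℕ) (M s : ℤ) (hs : 0 < s) :
    Dp ν q (n + 1) M s = Sp ν q n (M + 1) (s - 1) := by
  rw [Dp, Sp, sum_cons]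
  refine Finset.sum_congr rfl fun d _ => ?_
  have h : ∀ c, SSE (Fin.cons c d : Fin (n + 1) → Fin 3) ↔ c = 1 := by
    intro c
    constructor
    · rintro ⟨_, h⟩; exact h
    · intro h; exact ⟨Nat.succ_pos n, (show (Fin.cons c d : Fin (n + 1) → Fin 3) 0 = 1 from h)⟩
  simp only [valid_cons, pwt_cons, h]
  simp [stepVal, sub_eq_add_neg, hs]

theorem Up_le (ν : ℕ) (q : F) (hq : q ≠ 0) (n : ℕ) (M s : ℤ) (hs : s ≤ ν) :
    Up ν q n M s = Sp ν q n M s - (1 - q ^ M) * Dp ν q n M s := by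
  rw [Up, Sp, Dp, Finset.mul_sum, ← Finset.sum_sub_distrib]
  refine Finset.sum_congr rfl fun d _ => ?_
  by_cases h1 : ValidPath ν s 0 d <;> by_cases h2 : SSE d <;> simp [h1, h2, hs]
  rw [zpow_add₀ hq]
  ring

theorem no_path (ν : ℕ) : ∀ (n : ℕ) (s : ℤ) (d : Fin n → Fin 3), (ν : ℤ) < s →
    ¬ (ValidPath ν s 0 d ∧ (SSE d → s ≤ ν)) := by
  intro n
  induction n with
  | zero =>
    rintro s d hs ⟨⟨h, _⟩, _⟩
    rw [hts_zero] at h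
    omega
  | succ n ih =>
    rintro s d hs ⟨h1, h2⟩
    obtain ⟨c, d, rfl⟩ : ∃ c d', d = Fin.cons c d' := ⟨d 0, Fin.tail d, (Fin.cons_self_tail d).symm⟩
    rw [valid_cons] at h1
    obtain ⟨ha, hb, hc, hd⟩ := h1
    have h3 : c ≠ 1 := by
      intro h
      have := h2 ⟨Nat.succ_pos n, (show (Fin.cons c d : Fin (n + 1) → Fin 3) 0 = 1 from h)⟩
      omega
    have h4 : c ≠ 2 := by
      intro h
      have := hb h
      omega
    have h5 : c = 0 := by
      fin_cases c <;> simp_all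
    subst h5
    refine ih (s + 1) d (by omega) ⟨by simpa [stepVal] using hc, fun h => hd rfl h⟩

theorem Up_gt (ν : ℕ) (q : F) (n : ℕ) (M s : ℤ) (hs : (ν : ℤ) < s) :
    Up ν q n M s = 0 := by
  rw [Up]
  refine Finset.sum_eq_zero fun d _ => ?_
  rw [if_neg (no_path ν n s d hs)]

theorem Sp_zero (ν : ℕ) (q : F) (M s : ℤ) : Sp ν q 0 M s = if s = 0 then 1 else 0 := by
  have hv : ∀ d : Fin 0 → Fin 3, ValidPath ν s 0 d ↔ s = 0 := by
    intro d
    unfold ValidPath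
    rw [hts_zero]
    constructor
    · exact fun h => h.1
    · exact fun h => ⟨h, fun k => k.elim0, fun k ⟨hk, _⟩ => by omega⟩
  have hp : ∀ d : Fin 0 → Fin 3, pwt M d = 0 := by
    intro d
    simp [pwt, isPeak_zero]
  simp [Sp, hv, hp]

theorem Sp_eq (ν : ℕ) (q : F) (hq : q ≠ 0) : ∀ (n : ℕ) (M : ℤ) (s : ℕ), s ≤ ν →
    Sp ν q n M s = Atr ν q (n + 1) (q ^ M) s := by
  intro n
  induction n using Nat.strong_induction_on with
  | _ n ih =>
    intro M s hs
    rcases n with _ | n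
    · rw [Sp_zero]
      simp [Atr]
    · rw [Sp_succ, Atr, ← zpow_add_one₀ hq, ← zpow_add_one₀ hq]
      have hdown : (if 0 < (s : ℤ) then Sp ν q n (M + 1) (s - 1) else 0) +
          (if (s : ℤ) = 0 then Sp ν q n (M + 1) s else 0) =
          Atr ν q (n + 1) (q ^ (M + 1)) (s - 1) := by
        rcases s with _ | s
        · simpa using ih n (by omega) (M + 1) 0 (by omega)
        · rw [if_pos (by positivity), if_neg (by positivity)]
          have := ih n (by omega) (M + 1) s (by omega)
          simpa using this
      rw [add_assoc, hdown]
      rcases Nat.lt_or_ge s ν with h1 | h1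
      · rw [if_pos h1, Up_le ν q hq _ _ _ (by omega)]
        have e1 := ih n (by omega) (M + 1) (s + 1) (by omega)
        push_cast at e1
        rw [e1]
        have e2 : Dp ν q n (M + 1) (s + 1) = Atr ν q n (q ^ (M + 1 + 1)) s := by
          rcases n with _ | n
          · rw [Dp_zero]; simp [Atr]
          · rw [Dp_succ _ _ _ _ _ (by positivity), add_sub_cancel_right]
            exact ih n (by omega) _ _ hs
        rw [e2]
        ring
      · rw [if_neg (by omega), if_pos (by omega), Up_gt _ _ _ _ _ (by omega), zero_add]

theorem Cpoly_eq (ν : ℕ) (q : F) (hq : q ≠ 0) (n : ℕ) (L : ℤ) (hL : L = n) (s : ℕ) (hs : s ≤ ν) :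
    Cpoly ν 0 L s 0 q = Atr ν q (n + 1) 1 s := by
  have h0 : Cpoly ν 0 L s 0 q = Sp ν q (L - 0).toNat 0 s := by
    rw [Cpoly, Sp, Finset.sum_filter]
    rfl
  rw [h0, Sp_eq ν q hq _ _ _ hs, hL]
  simp

/-! the fermionic side -/

/-- summand -/
def trm (ν : ℕ) (q : F) (L : ℤ) (nn : Fin ν → ℕ) : F :=
  q ^ (∑ i ∈ Finset.Icc 1 ν, (NN nn i) ^ 2) * ∏ i : Fin ν, qB q
    ((nn i : ℤ) + L - 2 * ∑ l ∈ Finset.Icc 1 ((i : ℕ) + 1), (NN nn l : ℤ)) (nn i)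

theorem NN_cons_one {ν : ℕ} (n : ℕ) (nn : Fin ν → ℕ) :
    NN (Fin.cons n nn : Fin (ν + 1) → ℕ) 1 = n + NN nn 1 := by
  simp [NN, Fin.sum_univ_succ]

theorem NN_cons_succ {ν : ℕ} (n : ℕ) (nn : Fin ν → ℕ) (i : ℕ) :
    NN (Fin.cons n nn : Fin (ν + 1) → ℕ) (i + 2) = NN nn (i + 1) := by
  simp [NN, Fin.sum_univ_succ]

theorem sum_Icc_one_succ {G' : Type*} [AddCommMonoid G'] (f : ℕ → G') (n : ℕ) :
    ∑ i ∈ Finset.Icc 1 n, f i = ∑ i ∈ Finset.range n, f (i + 1) := by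
  rw [Finset.range_eq_Ico, Finset.sum_Ico_add' f 0 n 1]
  rfl

theorem trm_cons {ν : ℕ} (q : F) (L : ℤ) (n : ℕ) (nn : Fin ν → ℕ) (N : ℕ)
    (hN : n + NN nn 1 = N) :
    trm (ν + 1) q L (Fin.cons n nn : Fin (ν + 1) → ℕ) =
      q ^ (N ^ 2) * qB q ((n : ℤ) + L - 2 * N) n * trm ν q (L - 2 * N) nn := by
  unfold trm
  rw [Fin.prod_univ_succ]
  simp only [sum_Icc_one_succ, Finset.sum_range_succ', zero_add, NN_cons_one, hN]
  simp only [NN_cons_succ, Fin.cons_zero, Fin.cons_succ, Fin.val_zero, Fin.val_succ,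
    Finset.range_zero, Finset.sum_empty, zero_add, pow_add,
    Finset.sum_range_succ', NN_cons_one, hN]
  have : ∀ i : Fin ν, (nn i : ℤ) + L - 2 *
      (∑ x ∈ Finset.range (i : ℕ), (NN nn (x + 1 + 1) : ℤ) + NN nn 1 + N) =
      (nn i : ℤ) + (L - 2 * N) -
        2 * (∑ x ∈ Finset.range (i : ℕ), (NN nn (x + 1 + 1) : ℤ) + NN nn 1) := by
    intro i; ring
  simp only [this]
  ring

theorem sum_pi_cons {ν : ℕ} (R : ℕ) (f : (Fin (ν + 1) → ℕ) → F) :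
    ∑ nn ∈ Fintype.piFinset (fun _ : Fin (ν + 1) => Finset.range R), f nn =
    ∑ nn ∈ Fintype.piFinset (fun _ : Fin ν => Finset.range R),
      ∑ n ∈ Finset.range R, f (Fin.cons n nn) := by
  rw [Finset.sum_comm, ← Finset.sum_product']
  refine Finset.sum_nbij' (fun f => (f 0, Fin.tail f)) (fun p => Fin.cons p.1 p.2) ?_ ?_ ?_ ?_ ?_
  · intro a ha
    simp only [Fintype.mem_piFinset, Finset.mem_product] at *
    exact ⟨ha 0, fun i => ha i.succ⟩
  · intro p hp
    simp only [Fintype.mem_piFinset, Finset.mem_product] at *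
    intro i
    refine Fin.cases ?_ ?_ i
    · exact hp.1
    · intro i; exact hp.2 i
  · intro a _; exact Fin.cons_self_tail a
  · intro p _; rfl
  · intro a _; simp

theorem acf_nu_zero (q : F) (k N : ℕ) : acf 0 q (k + 1) N 0 = if N = 0 then 1 else 0 := by
  induction k with
  | zero => simp [acf]
  | succ k ih =>
    rcases N with _ | N
    · simp [acf_two_zero, ih]
    · simp [acf_two_succ, ih]

theorem ferm (q : F) (hq : ∀ n, qP q n ≠ 0) (ν : ℕ) : ∀ (R L N : ℕ), N < R →
    ∑ nn ∈ Fintype.piFinset (fun _ : Fin ν => Finset.range R),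
      (if NN nn 1 = N then trm ν q L nn else 0) = acf ν q (L + 1) N 0 := by
  induction ν with
  | zero =>
    intro R L N hN
    rw [acf_nu_zero]
    simp [NN, trm, eq_comm]
  | succ ν ih =>
    intro R L N hN
    rw [lift_main ν q hq _ _ _ (Nat.zero_le _), sum_pi_cons]
    simp only [NN_cons_one]
    have step : ∀ nn : Fin ν → ℕ, ∑ n ∈ Finset.range R, (if n + NN nn 1 = N then
        trm (ν + 1) q (L : ℤ) (Fin.cons n nn : Fin (ν + 1) → ℕ) else 0) =
        ∑ m ∈ Finset.range (N + 1), q ^ (N ^ 2) *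
          qB q (((N - m : ℕ) : ℤ) + L - 2 * N) ((N - m : ℕ) : ℤ) *
          (if NN nn 1 = m then trm ν q (L - 2 * N) nn else 0) := by
      intro nn
      by_cases h : NN nn 1 ≤ N
      · rw [Finset.sum_eq_single (N - NN nn 1), Finset.sum_eq_single (NN nn 1)]
        · rw [if_pos (by omega), if_pos rfl, trm_cons q L _ nn N (by omega)]
        · intro m _ hm
          rw [if_neg (Ne.symm hm), mul_zero]
        · intro hm
          simp at hm; omega
        · intro n _ hn
          rw [if_neg (by omega)]
        · intro hm
          simp at hm; omega
      · rw [Finset.sum_eq_zero, Finset.sum_eq_zero]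
        · intro m hm
          simp at hm
          rw [if_neg (by omega), mul_zero]
        · intro n _
          rw [if_neg (by omega)]
    rw [Finset.sum_congr rfl fun nn _ => step nn, Finset.sum_comm]
    simp only [← Finset.mul_sum]
    rcases Nat.lt_or_ge L (2 * N) with h | h
    · rw [Tl_small _ _ (by simp [acf]) _ _ (by omega)]
      refine Finset.sum_eq_zero fun m _ => ?_
      rw [qB, if_neg (by omega)]
      ring
    · obtain ⟨l, rfl⟩ := Nat.exists_eq_add_of_le h
      rw [Tl, Finset.mul_sum]
      refine Finset.sum_congr rfl fun m hm => ?_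
      have hm' : m ≤ N := by simpa [Nat.lt_succ_iff] using hm
      have := ih R l m (by omega)
      rw [show 2 * N + l + 1 - 2 * N - 1 = l by omega, show 2 * N + l + 1 - 2 * N = l + 1 by omega,
        ← this, ← qB_eq_bet]
      rw [show ((2 * N + l : ℕ) : ℤ) - 2 * N = l by push_cast; ring,
        show ((N - m : ℕ) : ℤ) + ((2 * N + l : ℕ) : ℤ) - 2 * N = l + ((N - m : ℕ) : ℤ) by
          push_cast; ring]
      ring

theorem le_NN {ν : ℕ} (nn : Fin ν → ℕ) (i : Fin ν) : nn i ≤ NN nn 1 := by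
  simp only [NN]
  have : ∀ k : Fin ν, (if 1 ≤ (k : ℕ) + 1 then nn k else 0) = nn k := by
    intro k; simp
  simp only [this]
  exact Finset.single_le_sum (f := nn) (fun _ _ => Nat.zero_le _) (Finset.mem_univ i)

theorem trm_support {ν : ℕ} (q : F) (L : ℕ) (nn : Fin ν → ℕ) (h : L < NN nn 1) :
    trm ν q L nn = 0 := by
  rcases ν with _ | ν
  · simp [NN] at h
  · obtain ⟨c, d, rfl⟩ : ∃ c d', nn = Fin.cons c d' :=
      ⟨nn 0, Fin.tail nn, (Fin.cons_self_tail nn).symm⟩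
    rw [NN_cons_one] at h
    rw [trm_cons q L c d _ rfl, qB, if_neg (by push_cast; omega)]
    ring

theorem ferm_total (q : F) (hq0 : q ≠ 0) (hq : ∀ n, qP q n ≠ 0) (ν M L : ℕ) :
    (∑ᶠ nn : Fin ν → ℕ,
      q ^ ((∑ i ∈ Finset.Icc 1 ν, (NN nn i : ℤ) ^ 2) - (M : ℤ) * (NN nn 1 : ℤ)) *
        ∏ i : Fin ν, qB q
          ((nn i : ℤ) + (L : ℤ) - 2 * ∑ l ∈ Finset.Icc 1 ((i : ℕ) + 1), (NN nn l : ℤ)) (nn i)) =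
    Atr ν q (L + 1) ((q ^ M)⁻¹) 0 := by
  have e : ∀ nn : Fin ν → ℕ,
      q ^ ((∑ i ∈ Finset.Icc 1 ν, (NN nn i : ℤ) ^ 2) - (M : ℤ) * (NN nn 1 : ℤ)) *
        ∏ i : Fin ν, qB q
          ((nn i : ℤ) + (L : ℤ) - 2 * ∑ l ∈ Finset.Icc 1 ((i : ℕ) + 1), (NN nn l : ℤ)) (nn i) =
      ((q ^ M)⁻¹) ^ (NN nn 1) * trm ν q L nn := by
    intro nn
    unfold trm
    rw [zpow_sub₀ hq0, div_eq_mul_inv]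
    rw [show (∑ i ∈ Finset.Icc 1 ν, (NN nn i : ℤ) ^ 2) =
      ((∑ i ∈ Finset.Icc 1 ν, (NN nn i) ^ 2 : ℕ) : ℤ) by push_cast; rfl, zpow_natCast,
      show (M : ℤ) * (NN nn 1 : ℤ) = ((M * NN nn 1 : ℕ) : ℤ) by push_cast; rfl, zpow_natCast,
      inv_pow, ← pow_mul]
    ring
  simp only [e]
  rw [finsum_eq_sum_of_support_subset (s := Fintype.piFinset (fun _ : Fin ν => Finset.range (L + 1)))]
  · rw [Atr_eq_sum ν q (L + 1) (L + 1) le_rfl]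
    have e3 : ∀ N ∈ Finset.range (L + 1), ((q ^ M)⁻¹) ^ N * acf ν q (L + 1) N 0 =
        ∑ nn ∈ Fintype.piFinset (fun _ : Fin ν => Finset.range (L + 1)),
          ((q ^ M)⁻¹) ^ N * (if NN nn 1 = N then trm ν q L nn else 0) := by
      intro N hN
      rw [← ferm q hq ν (L + 1) L N (Finset.mem_range.1 hN), Finset.mul_sum]
    rw [Finset.sum_congr rfl e3, Finset.sum_comm]
    refine Finset.sum_congr rfl fun nn _ => ?_
    by_cases h : NN nn 1 ≤ L
    · rw [Finset.sum_eq_single (NN nn 1)]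
      · simp
      · intro m _ hm
        rw [if_neg (Ne.symm hm), mul_zero]
      · intro hm
        simp at hm; omega
    · rw [trm_support q L nn (by omega)]
      simp
  · intro nn hnn
    simp only [Finset.mem_coe, Fintype.mem_piFinset, Finset.mem_range]
    intro i
    by_contra hcon
    apply hnn
    have := le_NN nn i
    simp only []
    rw [trm_support q L nn (by omega), mul_zero]

theorem X_pow_ne_one (n : ℕ) : (RatFunc.X : RatFunc ℚ) ^ (n + 1) ≠ 1 := by
  intro h
  rw [← RatFunc.algebraMap_X, ← map_pow, ← map_one (algebraMap (Polynomial ℚ) (RatFunc ℚ))] at h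
  have := RatFunc.algebraMap_injective ℚ h
  have := congrArg Polynomial.natDegree this
  simp at this

theorem qP_X_ne (n : ℕ) : qP (RatFunc.X : RatFunc ℚ) n ≠ 0 := by
  unfold qP
  rw [Finset.prod_ne_zero_iff]
  intro j _
  exact sub_ne_zero.2 (X_pow_ne_one j).symm

theorem glue_total (q : F) (hq0 : q ≠ 0) (ν M L : ℕ) (hML : M ≤ L) :
    ∑ s ∈ Finset.range (ν + 1),
      Cpoly ν 0 (M : ℤ) s 0 q⁻¹ * Cpoly ν 0 ((L : ℤ) - M) s 0 q =
    Atr ν q (L + 1) ((q ^ M)⁻¹) 0 := by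
  have := Hg_eq ν q hq0 M (L - M) ((q ^ M)⁻¹)
  rw [inv_mul_cancel₀ (pow_ne_zero _ hq0), show M + (L - M) = L by omega] at this
  rw [← this, Hg]
  simp only [sub_self, zero_mul, sub_zero]
  refine Finset.sum_congr rfl fun s hs => ?_
  have hs' : s ≤ ν := by simpa [Nat.lt_succ_iff] using hs
  rw [Cpoly_eq ν q⁻¹ (inv_ne_zero hq0) M _ rfl s hs', Cpoly_eq ν q hq0 (L - M) _ (by omega) s hs']

end helpers

theorem stmt_9 (ν : ℕ) (hν : 1 ≤ ν) (M L : ℕ) (hML : M ≤ L) :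
    (∑ᶠ nn : Fin ν → ℕ,
      (RatFunc.X : K) ^ ((∑ i ∈ Finset.Icc 1 ν, (NN nn i : ℤ) ^ 2) - (M : ℤ) * (NN nn 1 : ℤ)) *
        ∏ i : Fin ν, qB (RatFunc.X : K)
          ((nn i : ℤ) + (L : ℤ) - 2 * ∑ l ∈ Finset.Icc 1 ((i : ℕ) + 1), (NN nn l : ℤ)) (nn i)) =
    ∑ s ∈ Finset.range (ν + 1),
      Cpoly ν 0 (M : ℤ) s 0 ((RatFunc.X : K)⁻¹) * Cpoly ν 0 ((L : ℤ) - M) s 0 RatFunc.X := by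
  rw [ferm_total _ RatFunc.X_ne_zero qP_X_ne, glue_total _ RatFunc.X_ne_zero _ _ _ hML]

end
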